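/- arXiv:1705.09911 — 6 statements merged into one kernel-verified Lean document; each statement's English description precedes it below -/
import Mathlib

section
/- Let n ≥ 1 and let A be an elasticity tensor. Suppose there exists a fourth-order n-dimensional real tensor T = (t_{ijkl}) satisfying t_{ijkl} = t_{jilk} and t_{ijkl} + t_{jikl} = 2 a_{ijkl} for all i,j,k,l, such that ∑_{i,j,k,l} t_{ijkl} m_{ik} m_{jl} ≥ 0 for every matrix m ∈ ℝ^{n×n}. Then A is M-positive semidefinite. If moreover ∑_{i,j,k,l} t_{ijkl} m_{ik} m_{jl} > 0 for every nonzero matrix m ∈ ℝ^{n×n}, then A is M-positive definite. -/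
open Finset

noncomputable section

/-- Symmetry condition of an elasticity tensor: `a_{ijkl} = a_{jikl} = a_{ijlk}`. -/
def ElastSym {n : ℕ} (A : Fin n → Fin n → Fin n → Fin n → ℝ) : Prop :=
  ∀ i j k l, A i j k l = A j i k l ∧ A i j k l = A i j l k

/-- The scalar `A x² y² = ∑ a_{ijkl} x_i x_j y_k y_l`. -/
def tQuad {n : ℕ} (A : Fin n → Fin n → Fin n → Fin n → ℝ) (x y : Fin n → ℝ) : ℝ :=
  ∑ i, ∑ j, ∑ k, ∑ l, A i j k l * x i * x j * y k * y l

/-- The vector `(A x y²)_i = ∑ a_{ijkl} x_j y_k y_l`. -/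
def tAxyy {n : ℕ} (A : Fin n → Fin n → Fin n → Fin n → ℝ) (x y : Fin n → ℝ) : Fin n → ℝ :=
  fun i => ∑ j, ∑ k, ∑ l, A i j k l * x j * y k * y l

/-- The vector `(A x² y)_l = ∑ a_{ijkl} x_i x_j y_k`. -/
def tAxxy {n : ℕ} (A : Fin n → Fin n → Fin n → Fin n → ℝ) (x y : Fin n → ℝ) : Fin n → ℝ :=
  fun l => ∑ i, ∑ j, ∑ k, A i j k l * x i * x j * y k

/-- The matrix `(A x²)_{kl} = ∑ a_{ijkl} x_i x_j`. -/
def matAx2 {n : ℕ} (A : Fin n → Fin n → Fin n → Fin n → ℝ) (x : Fin n → ℝ) :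
    Matrix (Fin n) (Fin n) ℝ :=
  Matrix.of fun k l => ∑ i, ∑ j, A i j k l * x i * x j

/-- The matrix `(A y²)_{ij} = ∑ a_{ijkl} y_k y_l`. -/
def matAy2 {n : ℕ} (A : Fin n → Fin n → Fin n → Fin n → ℝ) (y : Fin n → ℝ) :
    Matrix (Fin n) (Fin n) ℝ :=
  Matrix.of fun i j => ∑ k, ∑ l, A i j k l * y k * y l

/-- The identity tensor `e_{ijkl} = 1` iff `i = j` and `k = l`. -/
def idT (n : ℕ) : Fin n → Fin n → Fin n → Fin n → ℝ :=
  fun i j k l => if i = j ∧ k = l then 1 else 0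

/-- `xᵀ x = 1`. -/
def unitVec {n : ℕ} (x : Fin n → ℝ) : Prop := ∑ i, x i * x i = 1

/-- `(λ, x, y)` is an M-eigenpair of `A`. -/
def IsMEig {n : ℕ} (A : Fin n → Fin n → Fin n → Fin n → ℝ) (lam : ℝ) (x y : Fin n → ℝ) :
    Prop :=
  (∀ i, tAxyy A x y i = lam * x i) ∧ (∀ l, tAxxy A x y l = lam * y l) ∧
    unitVec x ∧ unitVec y

/-- M-positive definiteness (the strong ellipticity condition). -/
def MPD {n : ℕ} (A : Fin n → Fin n → Fin n → Fin n → ℝ) : Prop :=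
  ∀ x y : Fin n → ℝ, x ≠ 0 → y ≠ 0 → 0 < tQuad A x y

/-- M-positive semidefiniteness. -/
def MPSD {n : ℕ} (A : Fin n → Fin n → Fin n → Fin n → ℝ) : Prop :=
  ∀ x y : Fin n → ℝ, 0 ≤ tQuad A x y

/-- All entries are nonnegative. -/
def NonnegT {n : ℕ} (A : Fin n → Fin n → Fin n → Fin n → ℝ) : Prop :=
  ∀ i j k l, 0 ≤ A i j k l

/-- The M-spectral radius of a nonnegative elasticity tensor:
`sup { B x² y² : xᵀx = yᵀy = 1 }`. -/
def rhoM {n : ℕ} (B : Fin n → Fin n → Fin n → Fin n → ℝ) : ℝ :=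
  sSup { r : ℝ | ∃ x y : Fin n → ℝ, unitVec x ∧ unitVec y ∧ r = tQuad B x y }

/-- An elasticity Z-tensor: all off-diagonal entries nonpositive. -/
def ZTensor {n : ℕ} (A : Fin n → Fin n → Fin n → Fin n → ℝ) : Prop :=
  ∀ i j k l, ¬(i = j ∧ k = l) → A i j k l ≤ 0

/-- A nonsingular elasticity M-tensor: `A = s E - B` with `B` nonnegative and `s > ρ_M(B)`. -/
def NonsingMT {n : ℕ} (A : Fin n → Fin n → Fin n → Fin n → ℝ) : Prop :=
  ∃ (s : ℝ) (B : Fin n → Fin n → Fin n → Fin n → ℝ),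
    ElastSym B ∧ NonnegT B ∧ (∀ i j k l, A i j k l = s * idT n i j k l - B i j k l) ∧
      rhoM B < s

/-- An elasticity M-tensor: `A = s E - B` with `B` nonnegative and `s ≥ ρ_M(B)`. -/
def ElastMT {n : ℕ} (A : Fin n → Fin n → Fin n → Fin n → ℝ) : Prop :=
  ∃ (s : ℝ) (B : Fin n → Fin n → Fin n → Fin n → ℝ),
    ElastSym B ∧ NonnegT B ∧ (∀ i j k l, A i j k l = s * idT n i j k l - B i j k l) ∧
      rhoM B ≤ s

/-- Irreducibility of a (nonnegative) square matrix. -/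
def MatIrred {n : ℕ} (M : Matrix (Fin n) (Fin n) ℝ) : Prop :=
  ∀ S : Finset (Fin n), S.Nonempty → S ≠ Finset.univ → ∃ k ∈ S, ∃ l ∉ S, M k l ≠ 0

/-- Strict diagonal dominance. -/
def SDD {n : ℕ} (M : Matrix (Fin n) (Fin n) ℝ) : Prop :=
  ∀ i, ∑ j ∈ Finset.univ.erase i, |M i j| < |M i i|

/-- Symmetrizing `T` in its first two indices gives `A`, so both have the same values
on rank-one matrices. -/
theorem tQuad_eq_sum_vecMulVec {n : ℕ} {A T : Fin n → Fin n → Fin n → Fin n → ℝ}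
    (hT : ∀ i j k l, T i j k l + T j i k l = 2 * A i j k l) (x y : Fin n → ℝ) :
    tQuad A x y = ∑ i, ∑ j, ∑ k, ∑ l,
      T i j k l * Matrix.vecMulVec x y i k * Matrix.vecMulVec x y j l := by
  have hswap : ∑ i, ∑ j, ∑ k, ∑ l, T i j k l * x i * x j * y k * y l =
      ∑ i, ∑ j, ∑ k, ∑ l, T j i k l * x i * x j * y k * y l := by
    rw [Finset.sum_comm]
    simp only [mul_right_comm]
  have hsum : ∑ i, ∑ j, ∑ k, ∑ l, T i j k l * x i * x j * y k * y l +
      ∑ i, ∑ j, ∑ k, ∑ l, T j i k l * x i * x j * y k * y l = 2 * tQuad A x y := by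
    simp only [tQuad, Finset.mul_sum, ← Finset.sum_add_distrib]
    refine Finset.sum_congr rfl fun i _ => Finset.sum_congr rfl fun j _ =>
      Finset.sum_congr rfl fun k _ => Finset.sum_congr rfl fun l _ => ?_
    linear_combination (x i * x j * y k * y l) * hT i j k l
  have hT_rank_one : ∑ i, ∑ j, ∑ k, ∑ l,
      T i j k l * Matrix.vecMulVec x y i k * Matrix.vecMulVec x y j l =
      ∑ i, ∑ j, ∑ k, ∑ l, T i j k l * x i * x j * y k * y l := by
    refine Finset.sum_congr rfl fun i _ => Finset.sum_congr rfl fun j _ =>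
      Finset.sum_congr rfl fun k _ => Finset.sum_congr rfl fun l _ => ?_
    simp only [Matrix.vecMulVec_apply]
    ring
  linarith

/-- if some tensor `T` with `t_{ijkl} = t_{jilk}` and
`t_{ijkl} + t_{jikl} = 2 a_{ijkl}` is S-PSD then `A` is M-PSD; if moreover `T` is
S-PD then `A` is M-PD. -/
theorem stmt_3 {n : ℕ} (hn : 1 ≤ n) (A : Fin n → Fin n → Fin n → Fin n → ℝ)
    (hA : ElastSym A) (T : Fin n → Fin n → Fin n → Fin n → ℝ)
    (hT1 : ∀ i j k l, T i j k l = T j i l k)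
    (hT2 : ∀ i j k l, T i j k l + T j i k l = 2 * A i j k l)
    (hpsd : ∀ m : Matrix (Fin n) (Fin n) ℝ,
      0 ≤ ∑ i, ∑ j, ∑ k, ∑ l, T i j k l * m i k * m j l) :
    MPSD A ∧
    ((∀ m : Matrix (Fin n) (Fin n) ℝ, m ≠ 0 →
        0 < ∑ i, ∑ j, ∑ k, ∑ l, T i j k l * m i k * m j l) → MPD A) := by
  refine ⟨fun x y => ?_, fun hpd x y hx hy => ?_⟩
  · rw [tQuad_eq_sum_vecMulVec hT2]
    exact hpsd _
  · rw [tQuad_eq_sum_vecMulVec hT2]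
    exact hpd _ (Matrix.vecMulVec_ne_zero hx hy)
end
end

section
/- Let n ≥ 1, let B be a nonnegative elasticity tensor, and let (λ, x, y) be an M-eigenpair of B (so xᵀx = yᵀy = 1). Then λ = B x² y², and |λ| ≤ B |x|² |y|² ≤ ρ_M(B), where |x| and |y| denote the componentwise absolute values of x and y. -/
open Finset

noncomputable section

theorem abs_tQuad_le {n : ℕ} {B : Fin n → Fin n → Fin n → Fin n → ℝ} (hB : NonnegT B)
    (x y : Fin n → ℝ) :
    |tQuad B x y| ≤ tQuad B (fun i => |x i|) (fun i => |y i|) := by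
  unfold tQuad
  refine (abs_sum_le_sum_abs _ _).trans (sum_le_sum fun i _ => ?_)
  refine (abs_sum_le_sum_abs _ _).trans (sum_le_sum fun j _ => ?_)
  refine (abs_sum_le_sum_abs _ _).trans (sum_le_sum fun k _ => ?_)
  refine (abs_sum_le_sum_abs _ _).trans (sum_le_sum fun l _ => ?_)
  simp only [abs_mul, abs_of_nonneg (hB i j k l), le_refl]

theorem unitVec.abs {n : ℕ} {x : Fin n → ℝ} (hx : unitVec x) : unitVec (fun i => |x i|) := by
  simpa only [unitVec, abs_mul_abs_self] using hx

theorem unitVec.abs_le_one {n : ℕ} {x : Fin n → ℝ} (hx : unitVec x) (i : Fin n) :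
    |x i| ≤ 1 := by
  have h : x i * x i ≤ 1 :=
    (single_le_sum (f := fun i => x i * x i) (fun j _ => mul_self_nonneg (x j))
      (mem_univ i)).trans_eq hx
  exact abs_le_one_iff_mul_self_le_one.mpr h

theorem tQuad_le_rhoM {n : ℕ} {B : Fin n → Fin n → Fin n → Fin n → ℝ} (hB : NonnegT B)
    {x y : Fin n → ℝ} (hx : unitVec x) (hy : unitVec y) : tQuad B x y ≤ rhoM B := by
  refine le_csSup ⟨∑ i, ∑ j, ∑ k, ∑ l, B i j k l, ?_⟩ ⟨x, y, hx, hy, rfl⟩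
  rintro _ ⟨u, v, hu, hv, rfl⟩
  refine (le_abs_self _).trans ((abs_tQuad_le hB u v).trans ?_)
  refine sum_le_sum fun i _ => sum_le_sum fun j _ => sum_le_sum fun k _ => sum_le_sum fun l _ => ?_
  have hb := hB i j k l
  calc B i j k l * |u i| * |u j| * |v k| * |v l|
      ≤ B i j k l * 1 * 1 * 1 * 1 := by
        gcongr
        exacts [hu.abs_le_one i, hu.abs_le_one j, hv.abs_le_one k, hv.abs_le_one l]
    _ = B i j k l := by ring

theorem tQuad_eq_sum_mul_tAxyy {n : ℕ} (A : Fin n → Fin n → Fin n → Fin n → ℝ)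
    (x y : Fin n → ℝ) : tQuad A x y = ∑ i, x i * tAxyy A x y i := by
  simp only [tQuad, tAxyy, mul_sum]
  refine sum_congr rfl fun i _ => sum_congr rfl fun j _ => sum_congr rfl fun k _ =>
    sum_congr rfl fun l _ => ?_
  ring

theorem IsMEig.eq_tQuad {n : ℕ} {A : Fin n → Fin n → Fin n → Fin n → ℝ} {lam : ℝ}
    {x y : Fin n → ℝ} (h : IsMEig A lam x y) : lam = tQuad A x y := by
  obtain ⟨hxy, -, hx, -⟩ := h
  calc lam = lam * ∑ i, x i * x i := by rw [show ∑ i, x i * x i = 1 from hx, mul_one]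
    _ = ∑ i, x i * tAxyy A x y i := by
        rw [mul_sum]
        exact sum_congr rfl fun i _ => by rw [hxy i]; ring
    _ = tQuad A x y := (tQuad_eq_sum_mul_tAxyy A x y).symm

/-- for a nonnegative elasticity tensor, any M-eigenvalue `λ` satisfies
`λ = B x² y²` and `|λ| ≤ B |x|² |y|² ≤ ρ_M(B)`. -/
theorem stmt_5 {n : ℕ} (hn : 1 ≤ n) (B : Fin n → Fin n → Fin n → Fin n → ℝ)
    (hB : ElastSym B) (hnn : NonnegT B)
    (lam : ℝ) (x y : Fin n → ℝ) (heig : IsMEig B lam x y) :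
    lam = tQuad B x y ∧
    |lam| ≤ tQuad B (fun i => |x i|) (fun i => |y i|) ∧
    tQuad B (fun i => |x i|) (fun i => |y i|) ≤ rhoM B := by
  have h := heig.eq_tQuad
  refine ⟨h, ?_, tQuad_le_rhoM hnn heig.2.2.1.abs heig.2.2.2.abs⟩
  rw [h]
  exact abs_tQuad_le hnn x y
end
end

section
/- Let n ≥ 1 and let B be a nonnegative elasticity tensor. Then ρ_M(B) = sup{ B x² y² : x, y ∈ ℝ^n, x ≥ 0, y ≥ 0, xᵀx = yᵀy = 1 }; that is, the supremum of B x² y² over all pairs of unit vectors equals the supremum over pairs of nonnegative unit vectors. -/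
open Finset

noncomputable section

theorem unitVec_abs {n : ℕ} {x : Fin n → ℝ} (hx : unitVec x) : unitVec fun i => |x i| := by
  simpa only [unitVec, abs_mul_abs_self] using hx

/-- Taking componentwise absolute values does not decrease the form of a nonnegative tensor. -/
theorem tQuad_le_tQuad_abs {n : ℕ} {B : Fin n → Fin n → Fin n → Fin n → ℝ} (hB : NonnegT B)
    (x y : Fin n → ℝ) : tQuad B x y ≤ tQuad B (fun i => |x i|) (fun i => |y i|) := by
  refine sum_le_sum fun i _ => sum_le_sum fun j _ => sum_le_sum fun k _ => sum_le_sum fun l _ => ?_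
  refine (le_abs_self _).trans_eq ?_
  simp only [abs_mul, abs_of_nonneg (hB i j k l)]

/-- for nonnegative `B`, the M-spectral radius equals the supremum of
`B x² y²` over pairs of nonnegative unit vectors. -/
theorem stmt_7 {n : ℕ} (hn : 1 ≤ n) (B : Fin n → Fin n → Fin n → Fin n → ℝ)
    (hB : ElastSym B) (hnn : NonnegT B) :
    rhoM B = sSup { r : ℝ | ∃ x y : Fin n → ℝ,
      (∀ i, 0 ≤ x i) ∧ (∀ i, 0 ≤ y i) ∧ unitVec x ∧ unitVec y ∧ r = tQuad B x y } := by
  refine csSup_eq_csSup_of_forall_exists_le ?_ ?_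
  · rintro _ ⟨x, y, hx, hy, rfl⟩
    exact ⟨_, ⟨fun i => |x i|, fun i => |y i|, fun i => abs_nonneg _, fun i => abs_nonneg _,
      unitVec_abs hx, unitVec_abs hy, rfl⟩, tQuad_le_tQuad_abs hnn x y⟩
  · rintro _ ⟨x, y, -, -, hx, hy, rfl⟩
    exact ⟨_, ⟨x, y, hx, hy, rfl⟩, le_rfl⟩
end
end

section
/- Let n ≥ 1 and let B be a nonnegative elasticity tensor such that for every i ∈ {1,…,n} the nonnegative n×n matrix B_y^{(i,i)} := (b_{iikl})_{k,l} is irreducible. Then for every nonzero x ∈ ℝ^n with x ≥ 0, the nonnegative symmetric matrix B x², with entries (B x²)_{kl} = ∑_{i,j} b_{ijkl} x_i x_j, is irreducible. -/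
open Finset

noncomputable section

/-- A diagonal slice is dominated by `A x²`. -/
theorem mul_mul_le_matAx2 {n : ℕ} {A : Fin n → Fin n → Fin n → Fin n → ℝ} (hA : NonnegT A)
    {x : Fin n → ℝ} (hx : ∀ i, 0 ≤ x i) (i k l : Fin n) :
    A i i k l * x i * x i ≤ matAx2 A x k l := by
  have hterm : ∀ a b, 0 ≤ A a b k l * x a * x b := fun a b =>
    mul_nonneg (mul_nonneg (hA a b k l) (hx a)) (hx b)
  calc A i i k l * x i * x i ≤ ∑ b, A i b k l * x i * x b :=
        Finset.single_le_sum (f := fun b => A i b k l * x i * x b)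
          (fun b _ => hterm i b) (Finset.mem_univ i)
    _ ≤ ∑ a, ∑ b, A a b k l * x a * x b :=
        Finset.single_le_sum (f := fun a => ∑ b, A a b k l * x a * x b)
          (fun a _ => Finset.sum_nonneg fun b _ => hterm a b) (Finset.mem_univ i)

/-- if every slice `B_y^{(i,i)} = (b_{iikl})_{k,l}` is irreducible, then
`B x²` is irreducible for every nonzero nonnegative `x`. -/
theorem stmt_9 {n : ℕ} (hn : 1 ≤ n) (B : Fin n → Fin n → Fin n → Fin n → ℝ)
    (hB : ElastSym B) (hnn : NonnegT B)
    (hirr : ∀ i : Fin n, MatIrred (Matrix.of fun k l => B i i k l))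
    (x : Fin n → ℝ) (hx0 : x ≠ 0) (hx : ∀ i, 0 ≤ x i) :
    MatIrred (matAx2 B x) := by
  intro S hS hSu
  obtain ⟨i, hi⟩ := Function.ne_iff.mp hx0
  have hxi : 0 < x i := (hx i).lt_of_ne' hi
  obtain ⟨k, hk, l, hl, hkl⟩ := hirr i S hS hSu
  have hpos : 0 < B i i k l := (hnn i i k l).lt_of_ne' hkl
  exact ⟨k, hk, l, hl,
    ((mul_pos (mul_pos hpos hxi) hxi).trans_le (mul_mul_le_matAx2 hnn hx i k l)).ne'⟩
end
end

section
/- Let n ≥ 1, let A be an elasticity Z-tensor, and set α := max{ a_{iikk} : i, k ∈ {1,…,n} }. Then A is a nonsingular elasticity M-tensor if and only if α > ρ_M(αE − A). (Note that αE − A is a nonnegative elasticity tensor, so ρ_M(αE − A) is defined.) -/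
open Finset

noncomputable section

/-- Shifting `-A` by `s E` shifts `A x² y²` by `s` on unit vectors. -/
theorem tQuad_mul_idT_sub {n : ℕ} (A : Fin n → Fin n → Fin n → Fin n → ℝ) (s : ℝ)
    {x y : Fin n → ℝ} (hx : unitVec x) (hy : unitVec y) :
    tQuad (fun i j k l => s * idT n i j k l - A i j k l) x y = s - tQuad A x y := by
  have hE : ∑ i, ∑ j, ∑ k, ∑ l, s * idT n i j k l * x i * x j * y k * y l = s := by
    have hterm : ∀ i j k l, s * idT n i j k l * x i * x j * y k * y l =
        if i = j then if k = l then s * (x i * x j) * (y k * y l) else 0 else 0 := by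
      intro i j k l
      by_cases hij : i = j <;> by_cases hkl : k = l <;> simp [idT, hij, hkl]
      ring
    have hinner : ∀ i j, (∑ k, ∑ l, s * idT n i j k l * x i * x j * y k * y l) =
        if i = j then s * (x i * x j) else 0 := by
      intro i j
      simp only [hterm]
      split_ifs with hij
      · simp only [Finset.sum_ite_eq, Finset.mem_univ, if_true]
        rw [← Finset.mul_sum, hy, mul_one]
      · simp
    simp only [hinner, Finset.sum_ite_eq, Finset.mem_univ, if_true]
    rw [← Finset.mul_sum, hx, mul_one]
  simp only [tQuad, sub_mul, Finset.sum_sub_distrib, hE]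

theorem bddAbove_tQuad {n : ℕ} (B : Fin n → Fin n → Fin n → Fin n → ℝ) :
    BddAbove { r : ℝ | ∃ x y : Fin n → ℝ, unitVec x ∧ unitVec y ∧ r = tQuad B x y } := by
  refine ⟨∑ i, ∑ j, ∑ k, ∑ l, |B i j k l|, ?_⟩
  rintro r ⟨x, y, hx, hy, rfl⟩
  refine Finset.sum_le_sum fun i _ => Finset.sum_le_sum fun j _ => Finset.sum_le_sum fun k _ =>
    Finset.sum_le_sum fun l _ => (le_abs_self _).trans ?_
  simp only [abs_mul]
  have hmul : ∀ {a b : ℝ}, 0 ≤ a → b ≤ 1 → a * b ≤ a := fun ha hb => mul_le_of_le_one_right ha hb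
  exact (hmul (by positivity) (hy.abs_le_one l)).trans <|
    (hmul (by positivity) (hy.abs_le_one k)).trans <|
    (hmul (by positivity) (hx.abs_le_one j)).trans <|
    hmul (by positivity) (hx.abs_le_one i)

theorem exists_unitVec {n : ℕ} (hn : 1 ≤ n) : ∃ x : Fin n → ℝ, unitVec x :=
  ⟨Pi.single ⟨0, hn⟩ 1, by simp [unitVec, Pi.single_apply]⟩

theorem rhoM_mul_idT_sub_le {n : ℕ} (hn : 1 ≤ n) (A : Fin n → Fin n → Fin n → Fin n → ℝ)
    (s t : ℝ) :
    rhoM (fun i j k l => s * idT n i j k l - A i j k l) ≤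
      s - t + rhoM (fun i j k l => t * idT n i j k l - A i j k l) := by
  obtain ⟨v, hv⟩ := exists_unitVec hn
  refine csSup_le ⟨_, v, v, hv, hv, rfl⟩ ?_
  rintro r ⟨x, y, hx, hy, rfl⟩
  have h := le_csSup (bddAbove_tQuad fun i j k l => t * idT n i j k l - A i j k l)
    ⟨x, y, hx, hy, rfl⟩
  rw [tQuad_mul_idT_sub A t hx hy] at h
  rw [tQuad_mul_idT_sub A s hx hy, rhoM]
  linarith

theorem elastSym_idT (n : ℕ) : ElastSym (idT n) := fun i j k l => by
  simp only [idT, eq_comm (a := i), eq_comm (a := k), and_self]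

/-- an elasticity Z-tensor `A` is a nonsingular elasticity M-tensor iff
`α > ρ_M(α E − A)`, where `α` is the greatest diagonal entry of `A`. -/
theorem stmt_11 {n : ℕ} (hn : 1 ≤ n) (A : Fin n → Fin n → Fin n → Fin n → ℝ)
    (hA : ElastSym A) (hZ : ZTensor A)
    (α : ℝ) (hα : IsGreatest { r : ℝ | ∃ i k : Fin n, r = A i i k k } α) :
    NonsingMT A ↔ rhoM (fun i j k l => α * idT n i j k l - A i j k l) < α := by
  constructor
  · rintro ⟨s, B, -, -, hAB, hs⟩
    have hB : B = fun i j k l => s * idT n i j k l - A i j k l := by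
      funext i j k l
      rw [hAB]
      ring
    rw [hB] at hs
    linarith [rhoM_mul_idT_sub_le hn A α s]
  · intro h
    refine ⟨α, _, fun i j k l => ?_, fun i j k l => ?_, fun i j k l => ?_, h⟩
    · rw [← (hA i j k l).1, ← (hA i j k l).2, ← (elastSym_idT n i j k l).1,
        ← (elastSym_idT n i j k l).2]
      exact ⟨rfl, rfl⟩
    · by_cases hd : i = j ∧ k = l
      · obtain ⟨rfl, rfl⟩ := hd
        simpa [idT] using hα.2 ⟨i, k, rfl⟩
      · simpa [idT, hd] using hZ i j k l hd
    · ring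
end
end

section
/- Let n ≥ 1 and let A be an elasticity Z-tensor. Then A is a nonsingular elasticity M-tensor if and only if A is M-positive definite, i.e. if and only if A x² y² > 0 for all nonzero x, y ∈ ℝ^n (the strong ellipticity condition). -/
open Finset

noncomputable section

lemma tQuad_idT {n : ℕ} (x y : Fin n → ℝ) :
    tQuad (idT n) x y = (∑ i, x i * x i) * ∑ k, y k * y k := by
  have h : ∀ i j k l : Fin n, idT n i j k l * x i * x j * y k * y l =
      if i = j then (if k = l then x i * x j * (y k * y l) else 0) else 0 := by
    intro i j k l
    by_cases hij : i = j <;> by_cases hkl : k = l <;> simp [idT, hij, hkl, mul_assoc]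
  simp_rw [tQuad, h, Finset.sum_mul_sum]
  refine Finset.sum_congr rfl fun i _ => ?_
  rw [Finset.sum_eq_single i]
  · simp
  · intro j _ hj
    simp [Ne.symm hj]
  · simp

lemma tQuad_smul_idT_sub {n : ℕ} {A B : Fin n → Fin n → Fin n → Fin n → ℝ} {s : ℝ}
    (h : ∀ i j k l, A i j k l = s * idT n i j k l - B i j k l) (x y : Fin n → ℝ) :
    tQuad A x y = s * ((∑ i, x i * x i) * ∑ k, y k * y k) - tQuad B x y := by
  rw [← tQuad_idT]
  simp_rw [tQuad, h, Finset.mul_sum, ← Finset.sum_sub_distrib]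
  simp_rw [sub_mul, mul_assoc]

lemma tQuad_smul_smul {n : ℕ} (A : Fin n → Fin n → Fin n → Fin n → ℝ) (a b : ℝ)
    (x y : Fin n → ℝ) : tQuad A (a • x) (b • y) = a ^ 2 * b ^ 2 * tQuad A x y := by
  simp_rw [tQuad, Finset.mul_sum, Pi.smul_apply, smul_eq_mul]
  congr! 4
  ring

lemma isCompact_unitVec (n : ℕ) : IsCompact {x : Fin n → ℝ | unitVec x} := by
  refine Metric.isCompact_of_isClosed_isBounded ?_ ?_
  · exact isClosed_eq (by fun_prop) continuous_const
  · refine isBounded_iff_forall_norm_le.2 ⟨1, fun x hx => ?_⟩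
    refine (pi_norm_le_iff_of_nonneg zero_le_one).2 fun i => ?_
    have h : x i * x i ≤ ∑ j, x j * x j :=
      Finset.single_le_sum (f := fun j => x j * x j) (fun j _ => mul_self_nonneg (x j))
        (Finset.mem_univ i)
    rw [show ∑ j, x j * x j = 1 from hx] at h
    exact abs_le_one_iff_mul_self_le_one.2 h

lemma isCompact_tQuad_values {n : ℕ} (B : Fin n → Fin n → Fin n → Fin n → ℝ) :
    IsCompact {r : ℝ | ∃ x y : Fin n → ℝ, unitVec x ∧ unitVec y ∧ r = tQuad B x y} := by
  have hc : Continuous fun p : (Fin n → ℝ) × (Fin n → ℝ) => tQuad B p.1 p.2 := by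
    unfold tQuad
    fun_prop
  convert ((isCompact_unitVec n).prod (isCompact_unitVec n)).image hc using 1
  ext r
  constructor
  · rintro ⟨x, y, hx, hy, rfl⟩
    exact ⟨(x, y), ⟨hx, hy⟩, rfl⟩
  · rintro ⟨⟨x, y⟩, ⟨hx, hy⟩, rfl⟩
    exact ⟨x, y, hx, hy, rfl⟩

lemma exists_tQuad_eq_rhoM {n : ℕ} (hn : 1 ≤ n) (B : Fin n → Fin n → Fin n → Fin n → ℝ) :
    ∃ x y : Fin n → ℝ, unitVec x ∧ unitVec y ∧ rhoM B = tQuad B x y := by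
  refine (isCompact_tQuad_values B).sSup_mem ?_
  have h : unitVec (Pi.single (⟨0, hn⟩ : Fin n) (1 : ℝ)) := by
    simp [unitVec, Pi.single_apply]
  exact ⟨_, _, _, h, h, rfl⟩

lemma sum_mul_self_pos {n : ℕ} {x : Fin n → ℝ} (hx : x ≠ 0) : 0 < ∑ i, x i * x i := by
  obtain ⟨i, hi⟩ := Function.ne_iff.1 hx
  exact Finset.sum_pos' (fun j _ => mul_self_nonneg (x j))
    ⟨i, Finset.mem_univ i, mul_self_pos.2 hi⟩

lemma unitVec.ne_zero {n : ℕ} {x : Fin n → ℝ} (hx : unitVec x) : x ≠ 0 := by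
  rintro rfl
  simp [unitVec] at hx

lemma exists_unitVec_smul {n : ℕ} {x : Fin n → ℝ} (hx : x ≠ 0) :
    ∃ a : ℝ, a ≠ 0 ∧ unitVec (a • x) := by
  have h := sum_mul_self_pos hx
  refine ⟨(√(∑ i, x i * x i))⁻¹, inv_ne_zero (Real.sqrt_pos.2 h).ne', ?_⟩
  simp only [unitVec, Pi.smul_apply, smul_eq_mul]
  simp_rw [mul_mul_mul_comm _ (x _)]
  rw [← Finset.mul_sum, ← mul_inv, Real.mul_self_sqrt h.le, inv_mul_cancel₀ h.ne']

lemma NonsingMT.mpd {n : ℕ} {A : Fin n → Fin n → Fin n → Fin n → ℝ} (h : NonsingMT A) :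
    MPD A := by
  obtain ⟨s, B, -, -, hAB, hs⟩ := h
  intro x y hx hy
  obtain ⟨a, ha, hax⟩ := exists_unitVec_smul hx
  obtain ⟨b, hb, hby⟩ := exists_unitVec_smul hy
  have hle : tQuad B (a • x) (b • y) ≤ rhoM B :=
    le_csSup (isCompact_tQuad_values B).bddAbove ⟨_, _, hax, hby, rfl⟩
  have hA := tQuad_smul_idT_sub hAB (a • x) (b • y)
  rw [hax, hby, tQuad_smul_smul A] at hA
  exact (mul_pos_iff_of_pos_left (by positivity : 0 < a ^ 2 * b ^ 2)).1 (by linarith)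

lemma MPD.nonsingMT {n : ℕ} (hn : 1 ≤ n) {A : Fin n → Fin n → Fin n → Fin n → ℝ}
    (hA : ElastSym A) (hZ : ZTensor A) (h : MPD A) : NonsingMT A := by
  set s : ℝ := ∑ i, ∑ k, |A i i k k| with hs
  set B : Fin n → Fin n → Fin n → Fin n → ℝ :=
    fun i j k l => s * idT n i j k l - A i j k l with hB
  have hAB : ∀ i j k l, A i j k l = s * idT n i j k l - B i j k l := fun i j k l => by
    simp [hB]
  refine ⟨s, B, fun i j k l => ?_, fun i j k l => ?_, hAB, ?_⟩
  · simp only [hB, idT, eq_comm (a := j) (b := i), eq_comm (a := l) (b := k)]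
    exact ⟨by rw [(hA i j k l).1], by rw [(hA i j k l).2]⟩
  · by_cases hd : i = j ∧ k = l
    · obtain ⟨rfl, rfl⟩ := hd
      have h₁ : |A i i k k| ≤ ∑ m, |A i i m m| :=
        Finset.single_le_sum (f := fun m => |A i i m m|) (fun _ _ => abs_nonneg _)
          (Finset.mem_univ k)
      have h₂ : ∑ m, |A i i m m| ≤ s :=
        Finset.single_le_sum (f := fun p => ∑ m, |A p p m m|)
          (fun _ _ => Finset.sum_nonneg fun _ _ => abs_nonneg _) (Finset.mem_univ i)
      simp only [hB, idT, and_self, if_true, mul_one]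
      linarith [le_abs_self (A i i k k)]
    · simpa [hB, idT, hd] using hZ i j k l hd
  · obtain ⟨x, y, hx, hy, hxy⟩ := exists_tQuad_eq_rhoM hn B
    have hpos := h x y hx.ne_zero hy.ne_zero
    rw [tQuad_smul_idT_sub hAB, hx, hy] at hpos
    linarith

/-- an elasticity Z-tensor is a nonsingular elasticity M-tensor iff it is
M-positive definite (strong ellipticity). -/
theorem stmt_13 {n : ℕ} (hn : 1 ≤ n) (A : Fin n → Fin n → Fin n → Fin n → ℝ)
    (hA : ElastSym A) (hZ : ZTensor A) :
    NonsingMT A ↔ MPD A :=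
  ⟨NonsingMT.mpd, MPD.nonsingMT hn hA hZ⟩
end
end
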